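/- Fix b ∈ (0,3) and let u be a global classical H² solution with nonnegative momentum of the b-family equation. Then there exists σ > 0 such that for every p ∈ [1, ∞], lim_{t→∞} ( ‖u(t,·)‖_{L^p((σt,∞))} + ‖∂_x u(t,·)‖_{L^p((σt,∞))} ) = 0; that is, u(t) tends to 0 in W^{1,p} on the exterior region (σt, ∞). -/

import Mathlib

open MeasureTheory Real Filter

/-- Convolution with the Green's function of `1 - d²/dx²` on `ℝ`. -/
noncomputable def G (f : ℝ → ℝ) (x : ℝ) : ℝ :=
  (1 / 2) * ∫ y : ℝ, Real.exp (-|x - y|) * f y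

/-- The flux of the nonlocal `b`-family equation at time `t`:
`(1/2)u² + G((b/2)u² + ((3-b)/2)(∂ₓu)²)`. -/
noncomputable def flux (b : ℝ) (u : ℝ → ℝ → ℝ) (t : ℝ) : ℝ → ℝ :=
  fun y => (1 / 2) * (u t y) ^ 2
    + G (fun z => (b / 2) * (u t z) ^ 2 + ((3 - b) / 2) * (deriv (u t) z) ^ 2) y

/-- The momentum `m = u - ∂ₓ²u`. -/
noncomputable def mom (u : ℝ → ℝ → ℝ) (t x : ℝ) : ℝ :=
  u t x - deriv (deriv (u t)) x

/-- `λ_c(t) = t^c / log t`. -/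
noncomputable def lam (c t : ℝ) : ℝ := t ^ c / Real.log t

/-- `sech² z`. -/
noncomputable def sech2 (z : ℝ) : ℝ := (1 / Real.cosh z) ^ 2

/-- A global classical `H²` solution with nonnegative momentum of the nonlocal `b`-family
equation: `C¹` in `t`, `C³` in `x`, jointly continuous partial derivatives, solving the
equation pointwise on `(0,∞) × ℝ`, with `u(t,·), ∂ₓu(t,·), ∂ₓ²u(t,·) ∈ L¹(ℝ) ∩ L²(ℝ)`,
nonnegative momentum `m(t,·) ≥ 0`, and conserved total momentum
`∫ m(t,x) dx = ∫ m(0,x) dx`. -/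
def IsH2NonnegMomentumSolution (b : ℝ) (u : ℝ → ℝ → ℝ) : Prop :=
  (∀ x : ℝ, ContDiff ℝ 1 fun t => u t x) ∧
  (∀ t : ℝ, ContDiff ℝ 3 (u t)) ∧
  Continuous (fun p : ℝ × ℝ => u p.1 p.2) ∧
  Continuous (fun p : ℝ × ℝ => deriv (fun s => u s p.2) p.1) ∧
  Continuous (fun p : ℝ × ℝ => deriv (u p.1) p.2) ∧
  Continuous (fun p : ℝ × ℝ => deriv (deriv (u p.1)) p.2) ∧
  Continuous (fun p : ℝ × ℝ => deriv (fun s => deriv (u s) p.2) p.1) ∧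
  Continuous (fun p : ℝ × ℝ => deriv (fun s => deriv (deriv (u s)) p.2) p.1) ∧
  (∀ t x : ℝ, 0 < t → deriv (fun s => u s x) t + deriv (flux b u t) x = 0) ∧
  (∀ t : ℝ, 0 ≤ t →
    Integrable (u t) ∧ Integrable (fun x => (u t x) ^ 2)
    ∧ Integrable (deriv (u t)) ∧ Integrable (fun x => (deriv (u t) x) ^ 2)
    ∧ Integrable (deriv (deriv (u t))) ∧ Integrable (fun x => (deriv (deriv (u t)) x) ^ 2)) ∧
  (∀ t x : ℝ, 0 ≤ t → 0 ≤ mom u t x) ∧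
  (∀ t : ℝ, 0 ≤ t → ∫ x : ℝ, mom u t x = ∫ x : ℝ, mom u 0 x)


/-! ### The weight -/

noncomputable def phiW (x : ℝ) : ℝ := Real.sigmoid (x / 4)

noncomputable def psiW (x : ℝ) : ℝ := phiW x * (1 - phiW x) / 4

lemma phiW_pos (x : ℝ) : 0 < phiW x := Real.sigmoid_pos _

lemma phiW_lt_one (x : ℝ) : phiW x < 1 := Real.sigmoid_lt_one _

lemma psiW_pos (x : ℝ) : 0 < psiW x := by
  have h1 := phiW_pos x
  have h2 := phiW_lt_one x
  unfold psiW
  have : 0 < 1 - phiW x := by linarith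
  positivity

lemma phiW_mono : Monotone phiW := fun a b h =>
  Real.sigmoid_monotone (by linarith)

lemma phiW_hasDerivAt (x : ℝ) : HasDerivAt phiW (psiW x) x := by
  have h := (Real.hasDerivAt_sigmoid (x / 4)).comp x ((hasDerivAt_id x).div_const 4)
  refine h.congr_deriv ?_
  simp [psiW, phiW]; ring

lemma phiW_cont : Continuous phiW :=
  continuous_iff_continuousAt.2 fun x => (phiW_hasDerivAt x).continuousAt

lemma psiW_cont : Continuous psiW := by
  unfold psiW
  have := phiW_cont
  fun_prop

lemma phiW_atTop : Tendsto phiW atTop (nhds 1) :=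
  Real.tendsto_sigmoid_atTop.comp (tendsto_id.atTop_div_const (by norm_num))

lemma phiW_atBot : Tendsto phiW atBot (nhds 0) :=
  Real.tendsto_sigmoid_atBot.comp (tendsto_id.atBot_div_const (by norm_num))

lemma phiW_neg (x : ℝ) : phiW (-x) = 1 - phiW x := by
  unfold phiW
  rw [neg_div, Real.sigmoid_neg]

lemma psiW_neg (x : ℝ) : psiW (-x) = psiW x := by
  unfold psiW
  rw [phiW_neg]; ring

lemma psiW_integrable : Integrable psiW := by
  have h1 : IntegrableOn psiW (Set.Ioi 0) :=
    integrableOn_Ioi_deriv_of_nonneg' (fun x _ => phiW_hasDerivAt x)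
      (fun x _ => (psiW_pos x).le) phiW_atTop
  have h2 : IntegrableOn psiW (Set.Iic 0) := by
    have h1' : IntegrableOn psiW (Set.Ioi (-0)) := by rwa [neg_zero]
    have := IntegrableOn.comp_neg_Iio (c := (0 : ℝ)) h1'
    simp only [psiW_neg] at this
    rwa [integrableOn_Iic_iff_integrableOn_Iio]
  have := h2.union h1
  rwa [Set.Iic_union_Ioi, integrableOn_univ] at this

lemma psiW_integral : ∫ x, psiW x = 1 := by
  rw [integral_of_hasDerivAt_of_tendsto phiW_hasDerivAt psiW_integrable phiW_atBot phiW_atTop]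
  norm_num

lemma phiW_ratio (a b : ℝ) : phiW a ≤ Real.exp (|a - b| / 4) * phiW b := by
  unfold phiW
  rw [Real.sigmoid_def, Real.sigmoid_def, ← div_eq_mul_inv, ← one_div, 
    div_le_div_iff₀ (by positivity) (by positivity)]
  have h1 : Real.exp (-(b / 4)) ≤ Real.exp (|a - b| / 4) * Real.exp (-(a / 4)) := by
    rw [← Real.exp_add]
    apply Real.exp_le_exp.2
    have := le_abs_self (a - b)
    linarith
  have h2 : 1 ≤ Real.exp (|a - b| / 4) := Real.one_le_exp (by positivity)
  nlinarith

lemma psiW_ratio (a b : ℝ) : psiW a ≤ Real.exp (|a - b| / 2) * psiW b := by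
  have h1 := phiW_ratio a b
  have h2 := phiW_ratio (-a) (-b)
  rw [phiW_neg, phiW_neg] at h2
  have h3 : |-a - -b| = |a - b| := by rw [← abs_neg]; congr 1; ring
  rw [h3] at h2
  have h4 : Real.exp (|a - b| / 2) = Real.exp (|a - b| / 4) * Real.exp (|a - b| / 4) := by
    rw [← Real.exp_add]; congr 1; ring
  rw [h4]
  unfold psiW
  have h5 := phiW_pos a
  have h6 := phiW_lt_one a
  have := mul_le_mul h1 h2 (by linarith) (h5.le.trans h1)
  linarith

lemma expHalf_integrable : Integrable (fun x : ℝ => Real.exp (-(|x| / 2))) := by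
  refine (psiW_integrable.div_const (psiW 0)).mono' (by fun_prop) (ae_of_all _ fun x => ?_)
  rw [Real.norm_of_nonneg (by positivity), le_div_iff₀ (psiW_pos 0)]
  have := psiW_ratio 0 x
  rw [zero_sub, abs_neg] at this
  calc _ ≤ Real.exp (-(|x| / 2)) * (Real.exp (|x| / 2) * psiW x) := by gcongr
    _ = psiW x := by rw [← mul_assoc, ← Real.exp_add]; simp

noncomputable def K0 : ℝ := ∫ x : ℝ, Real.exp (-(|x| / 2))

lemma K0_nonneg : 0 ≤ K0 := integral_nonneg fun x => by positivity

lemma G_psiW_le (s y : ℝ) :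
    ∫ x : ℝ, Real.exp (-|x - y|) * psiW (x - s) ≤ K0 * psiW (y - s) := by
  have hi : Integrable (fun x : ℝ => Real.exp (-(|x - y| / 2)) * psiW (y - s)) :=
    (expHalf_integrable.comp_sub_right y).mul_const _
  have hK : ∫ x : ℝ, Real.exp (-(|x - y| / 2)) * psiW (y - s) = K0 * psiW (y - s) := by
    rw [integral_mul_const, integral_sub_right_eq_self (fun x => Real.exp (-(|x| / 2))) y]
    rfl
  rw [← hK]
  refine integral_mono_of_nonneg (ae_of_all _ fun x => ?_) hi (ae_of_all _ fun x => ?_)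
  · exact mul_nonneg (Real.exp_pos _).le (psiW_pos _).le
  · have h := psiW_ratio (x - s) (y - s)
    rw [show x - s - (y - s) = x - y by ring] at h
    calc Real.exp (-|x - y|) * psiW (x - s)
        ≤ Real.exp (-|x - y|) * (Real.exp (|x - y| / 2) * psiW (y - s)) := by gcongr
      _ = _ := by rw [← mul_assoc, ← Real.exp_add]; congr 2; ring

/-! ### The operator `G` -/

lemma exp_abs_mul_integrable {f : ℝ → ℝ} (hf : Integrable f) (x : ℝ) :
    Integrable (fun y => Real.exp (-|x - y|) * f y) := by
  refine hf.norm.mono' ((by fun_prop : Continuous fun y : ℝ => Real.exp (-|x - y|)).aestronglyMeasurable.mul hf.1) (ae_of_all _ fun y => ?_)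
  rw [norm_mul, Real.norm_of_nonneg (Real.exp_pos _).le]
  have : Real.exp (-|x - y|) ≤ 1 := Real.exp_le_one_iff.2 (by simp)
  nlinarith [norm_nonneg (f y)]

lemma G_nonneg {f : ℝ → ℝ} (h : ∀ y, 0 ≤ f y) (x : ℝ) : 0 ≤ G f x :=
  mul_nonneg (by norm_num) (integral_nonneg fun y => mul_nonneg (Real.exp_pos _).le (h y))

lemma G_le {f : ℝ → ℝ} (hf : Integrable f) (h : ∀ y, 0 ≤ f y) (x : ℝ) :
    G f x ≤ (1 / 2) * ∫ y, f y := by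
  unfold G
  gcongr
  · exact exp_abs_mul_integrable hf x
  · intro y
    have : Real.exp (-|x - y|) ≤ 1 := Real.exp_le_one_iff.2 (by simp)
    have := h y
    simp only
    nlinarith

lemma exp_neg_abs_lip (p q : ℝ) : |Real.exp (-|p|) - Real.exp (-|q|)| ≤ |p - q| := by
  have key : ∀ p q : ℝ, Real.exp (-|p|) - Real.exp (-|q|) ≤ |p - q| := by
    intro p q
    have h1 : Real.exp (-|q|) = Real.exp (-|p|) * Real.exp (|p| - |q|) := by
      rw [← Real.exp_add]; congr 1; ring
    have h2 := Real.add_one_le_exp (|p| - |q|)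
    have h3 : Real.exp (-|p|) ≤ 1 := Real.exp_le_one_iff.2 (by simp)
    have h4 := Real.exp_pos (-|p|)
    have h5 := abs_sub_abs_le_abs_sub q p
    rw [abs_sub_comm] at h5
    have h6 := abs_nonneg (p - q)
    rw [h1]
    have h7 : Real.exp (-|p|) - Real.exp (-|p|) * Real.exp (|p| - |q|)
        ≤ Real.exp (-|p|) * (|q| - |p|) := by nlinarith
    have h8 : Real.exp (-|p|) * (|q| - |p|) ≤ Real.exp (-|p|) * |p - q| := by gcongr
    nlinarith
  rw [abs_le]
  have h1 := key p q
  have h2 := key q p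
  rw [abs_sub_comm] at h2
  constructor <;> linarith

lemma G_differentiable {f : ℝ → ℝ} (hf : Integrable f) : Differentiable ℝ (G f) := by
  intro x
  have h := hasDerivAt_integral_of_dominated_loc_of_lip (μ := volume) (𝕜 := ℝ) (x₀ := x)
    (F := fun x y => Real.exp (-|x - y|) * f y) (bound := fun y => |f y|) (s := Set.univ)
    (F' := fun y => Real.exp (-|x - y|) * (-(SignType.sign (x - y) : ℝ)) * f y)
    Filter.univ_mem (Eventually.of_forall fun z => (exp_abs_mul_integrable hf z).1)
    (exp_abs_mul_integrable hf x) ?_ ?_ hf.abs ?_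
  · exact (h.2.const_mul (1 / 2)).differentiableAt
  · refine AEStronglyMeasurable.mul ?_ hf.1
    have : Measurable (fun y : ℝ => (SignType.sign (x - y) : ℝ)) := by
      have hs : Measurable (fun z : ℝ => (SignType.sign z : ℝ)) := by
        have : (fun z : ℝ => (SignType.sign z : ℝ))
            = fun z => if 0 < z then 1 else if z < 0 then -1 else 0 := by
          funext z
          rcases lt_trichotomy z 0 with h | h | h
          · simp [h, not_lt.2 h.le]
          · simp [h]
          · simp [h]
        rw [this]
        exact Measurable.ite measurableSet_Ioi measurable_const
          (Measurable.ite measurableSet_Iio measurable_const measurable_const)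
      exact hs.comp (by fun_prop)
    exact ((by fun_prop : Measurable fun y : ℝ => Real.exp (-|x - y|)).mul this.neg).aestronglyMeasurable
  · refine ae_of_all _ fun y => ?_
    refine LipschitzOnWith.of_dist_le_mul fun p _ q _ => ?_
    simp only [Real.dist_eq, Real.coe_nnabs, abs_abs]
    rw [← sub_mul, abs_mul, mul_comm]
    have := exp_neg_abs_lip (p - y) (q - y)
    rw [show p - y - (q - y) = p - q by ring] at this
    gcongr
  · have hne : ∀ᵐ y : ℝ, y ≠ x := by
      simp [ae_iff]
    filter_upwards [hne] with y hy
    have h1 : HasDerivAt (fun z : ℝ => |z - y|) (SignType.sign (x - y) : ℝ) x := by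
      have := (hasDerivAt_abs (sub_ne_zero.2 hy.symm)).comp x ((hasDerivAt_id x).sub_const y)
      simpa [Function.comp_def] using this
    exact (h1.neg.exp).mul_const _

lemma psiW_G_integral_le {f : ℝ → ℝ} (hf : Integrable f) (hfc : Continuous f)
    (h : ∀ y, 0 ≤ f y) (s : ℝ) :
    ∫ x, G f x * psiW (x - s) ≤ (K0 / 2) * ∫ y, f y * psiW (y - s) := by
  have hψ : Integrable (fun x => psiW (x - s)) := psiW_integrable.comp_sub_right s
  have hψc : Continuous (fun x => psiW (x - s)) := psiW_cont.comp (by fun_prop)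
  have hI : Integrable (Function.uncurry fun x y : ℝ => Real.exp (-|x - y|) * f y * psiW (x - s))
      (volume.prod volume) := by
    have hp := hψ.mul_prod hf
    refine hp.mono' ?_ (ae_of_all _ ?_)
    · have : Continuous (Function.uncurry fun x y : ℝ => Real.exp (-|x - y|) * f y * psiW (x - s)) := by
        have h1 := hfc.comp (continuous_snd : Continuous (Prod.snd : ℝ × ℝ → ℝ))
        have h2 := hψc.comp (continuous_fst : Continuous (Prod.fst : ℝ × ℝ → ℝ))
        refine (Continuous.mul ?_ h1).mul h2
        fun_prop
      exact this.aestronglyMeasurable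
    · rintro ⟨x, y⟩
      simp only [Function.uncurry]
      have h1 : Real.exp (-|x - y|) ≤ 1 := Real.exp_le_one_iff.2 (by simp)
      have h2 := psiW_pos (x - s)
      have h3 := h y
      rw [Real.norm_of_nonneg (by positivity)]
      have := mul_nonneg h2.le h3
      nlinarith
  have e1 : ∫ x, G f x * psiW (x - s)
      = (1 / 2) * ∫ x, ∫ y, Real.exp (-|x - y|) * f y * psiW (x - s) := by
    rw [← integral_const_mul]
    congr 1
    funext x
    rw [integral_mul_const]
    unfold G
    ring
  rw [e1, integral_integral_swap hI]
  have e2 : ∀ y, ∫ x, Real.exp (-|x - y|) * f y * psiW (x - s)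
      = f y * ∫ x, Real.exp (-|x - y|) * psiW (x - s) := by
    intro y
    rw [← integral_const_mul]
    congr 1
    funext x
    ring
  have hb : Integrable (fun y => f y * psiW (y - s)) := by
    refine (hf.mul_const 1).mono' (hfc.mul hψc).aestronglyMeasurable (ae_of_all _ fun y => ?_)
    have h1 := phiW_pos (y - s)
    have h2 := phiW_lt_one (y - s)
    have h3 : psiW (y - s) ≤ 1 := by unfold psiW; nlinarith
    rw [Real.norm_of_nonneg (mul_nonneg (h y) (psiW_pos _).le)]
    exact mul_le_mul_of_nonneg_left h3 (h y)
  have e3 : ∫ y, ∫ x, Real.exp (-|x - y|) * f y * psiW (x - s)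
      ≤ ∫ y, K0 * (f y * psiW (y - s)) := by
    refine integral_mono_of_nonneg (ae_of_all _ fun y => ?_) (hb.const_mul _) (ae_of_all _ fun y => ?_)
    · exact integral_nonneg fun x =>
        mul_nonneg (mul_nonneg (Real.exp_pos _).le (h y)) (psiW_pos _).le
    · simp only [e2]
      have := mul_le_mul_of_nonneg_left (G_psiW_le s y) (h y)
      linarith
  rw [integral_const_mul] at e3
  linarith

/-! ### Single-time estimates -/

lemma slice_facts {v : ℝ → ℝ} (hv : ContDiff ℝ 3 v) (h0 : Integrable v)
    (h1 : Integrable (deriv v)) (h2 : Integrable (deriv (deriv v)))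
    (hm : ∀ x, 0 ≤ v x - deriv (deriv v) x) :
    (∀ x, |deriv v x| ≤ v x) ∧ (∫ x, v x = ∫ x, (v x - deriv (deriv v) x)) ∧
    (∀ x, v x ≤ ∫ y in Set.Ioi x, v y) := by
  have d1 : ∀ x, HasDerivAt v (deriv v x) x := fun x =>
    (hv.differentiable (by norm_num) x).hasDerivAt
  have hv' : ContDiff ℝ 2 (deriv v) := ((contDiff_succ_iff_deriv (n := 2)).1 (by norm_num; exact hv)).2.2
  have d2 : ∀ x, HasDerivAt (deriv v) (deriv (deriv v) x) x := fun x =>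
    (hv'.differentiable (by norm_num) x).hasDerivAt
  have t1 : Tendsto v atTop (nhds 0) := tendsto_zero_of_hasDerivAt_of_integrableOn_Ioi (a := 0)
    (fun x _ => d1 x) h1.integrableOn h0.integrableOn
  have t2 : Tendsto v atBot (nhds 0) := tendsto_zero_of_hasDerivAt_of_integrableOn_Iic (a := 0)
    (fun x _ => d1 x) h1.integrableOn h0.integrableOn
  have t3 : Tendsto (deriv v) atTop (nhds 0) := tendsto_zero_of_hasDerivAt_of_integrableOn_Ioi
    (a := 0) (fun x _ => d2 x) h2.integrableOn h1.integrableOn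
  have t4 : Tendsto (deriv v) atBot (nhds 0) := tendsto_zero_of_hasDerivAt_of_integrableOn_Iic
    (a := 0) (fun x _ => d2 x) h2.integrableOn h1.integrableOn
  have A : ∀ x, 0 ≤ v x - deriv v x := by
    have hd : ∀ x, HasDerivAt (fun x => Real.exp x * (v x - deriv v x))
        (Real.exp x * (v x - deriv (deriv v) x)) x := fun x =>
      ((Real.hasDerivAt_exp x).mul ((d1 x).sub (d2 x))).congr_deriv (by simp; ring)
    have hmono : Monotone (fun x => Real.exp x * (v x - deriv v x)) :=
      monotone_of_hasDerivAt_nonneg hd (fun x => mul_nonneg (Real.exp_pos x).le (hm x))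
    have ht : Tendsto (fun x => Real.exp x * (v x - deriv v x)) atBot (nhds 0) := by
      simpa using Real.tendsto_exp_atBot.mul (t2.sub t4)
    intro x
    have := hmono.le_of_tendsto ht x
    exact nonneg_of_mul_nonneg_right this (Real.exp_pos x)
  have B : ∀ x, 0 ≤ v x + deriv v x := by
    have hd : ∀ x, HasDerivAt (fun x => -(Real.exp (-x) * (v x + deriv v x)))
        (Real.exp (-x) * (v x - deriv (deriv v) x)) x := fun x =>
      (((hasDerivAt_neg x).exp.mul ((d1 x).add (d2 x))).neg).congr_deriv (by simp; ring)
    have hmono : Monotone (fun x => -(Real.exp (-x) * (v x + deriv v x))) :=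
      monotone_of_hasDerivAt_nonneg hd (fun x => mul_nonneg (Real.exp_pos _).le (hm x))
    have ht : Tendsto (fun x => -(Real.exp (-x) * (v x + deriv v x))) atTop (nhds 0) := by
      simpa using (Real.tendsto_exp_neg_atTop_nhds_zero.mul (t1.add t3)).neg
    intro x
    have := hmono.ge_of_tendsto ht x
    exact nonneg_of_mul_nonneg_right (by linarith : 0 ≤ Real.exp (-x) * (v x + deriv v x))
      (Real.exp_pos (-x))
  have C : ∀ x, |deriv v x| ≤ v x := fun x => abs_le.2 ⟨by linarith [B x], by linarith [A x]⟩
  refine ⟨C, ?_, fun x => ?_⟩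
  · rw [integral_sub h0 h2, integral_eq_zero_of_hasDerivAt_of_integrable d2 h2 h1, sub_zero]
  · have := integral_Ioi_of_hasDerivAt_of_tendsto' (a := x) (fun x _ => d1 x) h1.integrableOn t1
    have h3 : - ∫ y in Set.Ioi x, deriv v y ≤ ∫ y in Set.Ioi x, v y := by
      rw [← integral_neg]
      exact integral_mono h1.integrableOn.neg h0.integrableOn
        (fun y => by have := B y; simp only; linarith)
    linarith

lemma interval_le_integral {h : ℝ → ℝ} (hi : Integrable h) (h0 : ∀ x, 0 ≤ h x) {L : ℝ}
    (hL : 0 ≤ L) : ∫ x in (-L)..L, h x ≤ ∫ x, h x := by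
  rw [intervalIntegral.integral_of_le (by linarith)]
  exact setIntegral_le_integral hi (ae_of_all _ h0)

lemma psiW_le_one (x : ℝ) : psiW x ≤ 1 := by
  have h1 := phiW_pos x
  have h2 := phiW_lt_one x
  unfold psiW
  nlinarith

lemma mul_psiW_integrable {h : ℝ → ℝ} (hc : Continuous h) (C : ℝ) (hC : ∀ x, |h x| ≤ C) (s : ℝ) :
    Integrable (fun x => h x * psiW (x - s)) := by
  refine ((psiW_integrable.comp_sub_right s).const_mul C).mono'
    (hc.mul (psiW_cont.comp (by fun_prop))).aestronglyMeasurable (ae_of_all _ fun x => ?_)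
  rw [norm_mul, Real.norm_of_nonneg (psiW_pos _).le, Real.norm_eq_abs]
  exact mul_le_mul_of_nonneg_right (hC x) (psiW_pos _).le

lemma slice_ineq {b : ℝ} (hb : b ∈ Set.Ioo (0 : ℝ) 3) {v w F f : ℝ → ℝ} {M σ s L : ℝ}
    (hv : ContDiff ℝ 3 v) (h0 : Integrable v)
    (h02 : Integrable (fun x => v x ^ 2)) (h12 : Integrable (fun x => deriv v x ^ 2))
    (hvv : ∀ x, |deriv v x| ≤ v x) (hM : ∀ x, v x ≤ M) (hI : ∫ x, v x = M)
    (hf : f = fun z => (b / 2) * (v z) ^ 2 + ((3 - b) / 2) * (deriv v z) ^ 2)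
    (hF : F = fun y => (1 / 2) * (v y) ^ 2 + G f y)
    (hw : Continuous w) (hwF : ∀ x, w x + deriv F x = 0)
    (hσ : σ = M / 2 + K0 / 2 * (3 / 2 * M) + 1) (hL : 0 ≤ L) :
    ∫ x in (-L)..L, (w x * phiW (x - s) - σ * (v x * psiW (x - s)))
      ≤ (2 * M ^ 2 + σ * M) * (phiW (-L - s) + (1 - phiW (L - s))) := by
  obtain ⟨hb0, hb3⟩ := hb
  have hv0 : ∀ x, 0 ≤ v x := fun x => (abs_nonneg _).trans (hvv x)
  have hM0 : 0 ≤ M := (hv0 0).trans (hM 0)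
  have hK := K0_nonneg
  have hσ0 : 0 ≤ σ := by rw [hσ]; positivity
  have hvc : Continuous v := hv.continuous
  have hdc : Continuous (deriv v) := hv.continuous_deriv (by norm_num)
  have hvd : Differentiable ℝ v := hv.differentiable (by norm_num)
  have hfc : Continuous f := by rw [hf]; fun_prop
  have hfi : Integrable f := by rw [hf]; exact (h02.const_mul _).add (h12.const_mul _)
  have hf0 : ∀ x, 0 ≤ f x := fun x => by
    rw [hf]
    have : 0 < 3 - b := by linarith
    positivity
  have hsq : ∀ x, deriv v x ^ 2 ≤ v x ^ 2 := fun x => by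
    rw [← sq_abs (deriv v x)]
    exact pow_le_pow_left₀ (abs_nonneg _) (hvv x) 2
  have hfle : ∀ x, f x ≤ 3 / 2 * M * v x := fun x => by
    rw [hf]
    have h1 := hsq x
    have h2 : v x ^ 2 ≤ M * v x := by nlinarith [hM x, hv0 x]
    have : (3 - b) / 2 * deriv v x ^ 2 ≤ (3 - b) / 2 * v x ^ 2 :=
      mul_le_mul_of_nonneg_left h1 (by linarith)
    simp only
    nlinarith
  have hfint : ∫ x, f x ≤ 3 / 2 * M * M := by
    calc ∫ x, f x ≤ ∫ x, 3 / 2 * M * v x := integral_mono hfi (h0.const_mul _) hfle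
      _ = _ := by rw [integral_const_mul, hI]
  have hGd := G_differentiable hfi
  have hG0 := G_nonneg hf0
  have hGle : ∀ x, G f x ≤ 3 / 4 * M ^ 2 := fun x => by
    have := G_le hfi hf0 x
    nlinarith
  have hFd : Differentiable ℝ F := by
    rw [hF]; fun_prop
  have hF0 : ∀ x, 0 ≤ F x := fun x => by
    rw [hF]
    have := hG0 x
    simp only
    positivity
  have hFle : ∀ x, F x ≤ 2 * M ^ 2 := fun x => by
    rw [hF]
    have := hGle x
    have h2 : v x ^ 2 ≤ M ^ 2 := pow_le_pow_left₀ (hv0 x) (hM x) 2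
    simp only
    nlinarith
  have hψc : Continuous (fun x => psiW (x - s)) := psiW_cont.comp (by fun_prop)
  have hφc : Continuous (fun x => phiW (x - s)) := phiW_cont.comp (by fun_prop)
  have iF : Integrable (fun x => F x * psiW (x - s)) :=
    mul_psiW_integrable hFd.continuous (2 * M ^ 2) (fun x => by rw [abs_of_nonneg (hF0 x)]; exact hFle x) s
  have iv : Integrable (fun x => v x * psiW (x - s)) :=
    mul_psiW_integrable hvc M (fun x => by rw [abs_of_nonneg (hv0 x)]; exact hM x) s
  have iG : Integrable (fun x => G f x * psiW (x - s)) :=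
    mul_psiW_integrable hGd.continuous (3 / 4 * M ^ 2)
      (fun x => by rw [abs_of_nonneg (hG0 x)]; exact hGle x) s
  -- global flux bound
  have hglob : ∫ x, F x * psiW (x - s) ≤ σ * ∫ x, v x * psiW (x - s) := by
    have h1 : ∫ x, F x * psiW (x - s)
        ≤ ∫ x, (M / 2 * (v x * psiW (x - s)) + G f x * psiW (x - s)) := by
      refine integral_mono iF ((iv.const_mul _).add iG) fun x => ?_
      have h2 : v x ^ 2 ≤ M * v x := by nlinarith [hM x, hv0 x]
      have h3 := mul_le_mul_of_nonneg_right h2 (psiW_pos (x - s)).le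
      simp only [hF]
      nlinarith
    rw [integral_add (iv.const_mul _) iG, integral_const_mul] at h1
    have h2 := psiW_G_integral_le hfi hfc hf0 s
    have h3 : ∫ y, f y * psiW (y - s) ≤ ∫ y, 3 / 2 * M * (v y * psiW (y - s)) := by
      refine integral_mono_of_nonneg (ae_of_all _ fun x => mul_nonneg (hf0 x) (psiW_pos _).le)
        (iv.const_mul _) (ae_of_all _ fun x => ?_)
      have := mul_le_mul_of_nonneg_right (hfle x) (psiW_pos (x - s)).le
      simp only
      linarith
    rw [integral_const_mul] at h3
    have h4 : 0 ≤ ∫ x, v x * psiW (x - s) :=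
      integral_nonneg fun x => mul_nonneg (hv0 x) (psiW_pos _).le
    have h5 := mul_le_mul_of_nonneg_left h3 (by positivity : 0 ≤ K0 / 2)
    rw [hσ]
    nlinarith
  have htail : (∫ x, v x * psiW (x - s)) - ∫ x in (-L)..L, v x * psiW (x - s)
      ≤ M * (phiW (-L - s) + (1 - phiW (L - s))) := by
    have i1 : Integrable (fun x => M * psiW (x - s)) :=
      (psiW_integrable.comp_sub_right s).const_mul M
    have h1 := interval_le_integral (i1.sub iv)
      (fun x => by
        have := mul_le_mul_of_nonneg_right (hM x) (psiW_pos (x - s)).le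
        simp only [Pi.sub_apply]
        linarith) hL
    simp only [Pi.sub_apply] at h1
    rw [integral_sub i1 iv, intervalIntegral.integral_sub i1.intervalIntegrable
      iv.intervalIntegrable, integral_const_mul, intervalIntegral.integral_const_mul,
      integral_sub_right_eq_self (fun x => psiW x) s, psiW_integral,
      intervalIntegral.integral_eq_sub_of_hasDerivAt
        (f := fun x => phiW (x - s)) (fun x _ => ?_)
        (hψc.intervalIntegrable _ _)] at h1
    · linarith
    · exact (phiW_hasDerivAt (x - s)).comp_sub_const x s
  have hftc : ∫ x in (-L)..L, (w x * phiW (x - s) - F x * psiW (x - s))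
      = -(F L * phiW (L - s)) - -(F (-L) * phiW (-L - s)) := by
    refine intervalIntegral.integral_eq_sub_of_hasDerivAt
        (f := fun x => -(F x * phiW (x - s))) (fun x _ => ?_) ?_
    · have h1 := (hFd x).hasDerivAt
      have h2 := (phiW_hasDerivAt (x - s)).comp_sub_const x s
      refine (h1.mul h2).neg.congr_deriv ?_
      have := hwF x
      rw [show w x = - deriv F x by linarith]
      ring
    · exact ((hw.mul hφc).sub (hFd.continuous.mul hψc)).intervalIntegrable _ _
  have hloc := interval_le_integral iF (fun x => mul_nonneg (hF0 x) (psiW_pos _).le) hL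
  have hsplit : ∫ x in (-L)..L, (w x * phiW (x - s) - σ * (v x * psiW (x - s)))
      = (∫ x in (-L)..L, (w x * phiW (x - s) - F x * psiW (x - s)))
        + (∫ x in (-L)..L, F x * psiW (x - s)) - σ * ∫ x in (-L)..L, v x * psiW (x - s) := by
    rw [← intervalIntegral.integral_const_mul, ← intervalIntegral.integral_add,
      ← intervalIntegral.integral_sub]
    · congr 1; funext x; ring
    · exact (((hw.mul hφc).sub (hFd.continuous.mul hψc)).add
        (hFd.continuous.mul hψc)).intervalIntegrable _ _
    · exact (continuous_const.mul (hvc.mul hψc)).intervalIntegrable _ _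
    · exact ((hw.mul hφc).sub (hFd.continuous.mul hψc)).intervalIntegrable _ _
    · exact (hFd.continuous.mul hψc).intervalIntegrable _ _
  rw [hsplit, hftc]
  have g1 : 0 ≤ F L * phiW (L - s) := mul_nonneg (hF0 L) (phiW_pos _).le
  have g2 : F (-L) * phiW (-L - s) ≤ 2 * M ^ 2 * phiW (-L - s) :=
    mul_le_mul_of_nonneg_right (hFle _) (phiW_pos _).le
  have g3 := mul_le_mul_of_nonneg_left htail hσ0
  have g4 : 0 ≤ 2 * M ^ 2 * (1 - phiW (L - s)) :=
    mul_nonneg (by positivity) (by linarith [phiW_lt_one (L - s)])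
  nlinarith

/-- Fubini plus the fundamental theorem of calculus in time. -/
lemma time_identity {g g' : ℝ → ℝ → ℝ} (hg' : Continuous (fun p : ℝ × ℝ => g' p.1 p.2))
    (hc : ∀ t, Continuous (g t))
    (hd : ∀ t x, HasDerivAt (fun t => g t x) (g' t x) t) (T L : ℝ) (hL : 0 ≤ L) :
    (∫ x in (-L)..L, g T x) - ∫ x in (-L)..L, g 0 x
      = ∫ t in (0 : ℝ)..T, ∫ x in (-L)..L, g' t x := by
  have hl : -L ≤ L := by linarith
  have hInteg : Integrable (Function.uncurry g')
      ((volume.restrict (Set.uIoc 0 T)).prod (volume.restrict (Set.Ioc (-L) L))) := by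
    rw [Measure.prod_restrict]
    have : IntegrableOn (Function.uncurry g') (Set.uIcc 0 T ×ˢ Set.Icc (-L) L)
        (volume.prod volume) :=
      ContinuousOn.integrableOn_compact (isCompact_uIcc.prod isCompact_Icc)
        (Continuous.continuousOn hg')
    exact this.mono_set (Set.prod_mono Set.uIoc_subset_uIcc Set.Ioc_subset_Icc_self)
  have h := intervalIntegral_integral_swap (μ := volume.restrict (Set.Ioc (-L) L)) hInteg
  rw [← intervalIntegral.integral_sub ((hc T).intervalIntegrable _ _)
    ((hc 0).intervalIntegrable _ _)]
  simp only [intervalIntegral.integral_of_le hl]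
  rw [h]
  congr 1
  funext x
  rw [intervalIntegral.integral_eq_sub_of_hasDerivAt (f := fun t => g t x) (fun t _ => hd t x)]
  exact Continuous.intervalIntegrable (hg'.comp (by fun_prop : Continuous fun t : ℝ => (t, x))) _ _

lemma eLpNorm_le_of_L1_Linf {v : ℝ → ℝ} {a δ : ℝ} (hv0 : ∀ x, 0 ≤ v x)
    (hi : Integrable v) (hsup : ∀ x, a < x → v x ≤ δ) (hI : ∫ x in Set.Ioi a, v x ≤ δ)
    (p : ENNReal) (hp : 1 ≤ p) :
    eLpNorm v p (volume.restrict (Set.Ioi a)) ≤ ENNReal.ofReal δ := by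
  by_cases hpt : p = ⊤
  · rw [hpt, eLpNorm_exponent_top]
    refine eLpNormEssSup_le_of_ae_bound ?_
    filter_upwards [ae_restrict_mem measurableSet_Ioi] with x hx
    rw [Real.norm_of_nonneg (hv0 x)]
    exact hsup x hx
  · have hp0 : p ≠ 0 := fun h => by simp [h] at hp
    have hp1 : 1 ≤ p.toReal := by
      have := ENNReal.toReal_mono hpt hp
      simpa using this
    rw [eLpNorm_eq_lintegral_rpow_enorm_toReal hp0 hpt]
    have hL1 : ∫⁻ x in Set.Ioi a, ‖v x‖ₑ ≤ ENNReal.ofReal δ := by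
      have h := ofReal_integral_eq_lintegral_ofReal (hi.integrableOn (s := Set.Ioi a))
        (ae_of_all _ hv0)
      have h2 : ∫⁻ x in Set.Ioi a, ‖v x‖ₑ = ∫⁻ x in Set.Ioi a, ENNReal.ofReal (v x) :=
        lintegral_congr fun x => Real.enorm_of_nonneg (hv0 x)
      rw [h2, ← h]
      exact ENNReal.ofReal_le_ofReal hI
    have hmain : ∫⁻ x in Set.Ioi a, ‖v x‖ₑ ^ p.toReal ≤ ENNReal.ofReal δ ^ p.toReal := by
      calc ∫⁻ x in Set.Ioi a, ‖v x‖ₑ ^ p.toReal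
          ≤ ∫⁻ x in Set.Ioi a, ENNReal.ofReal δ ^ (p.toReal - 1) * ‖v x‖ₑ := by
            refine lintegral_mono_ae ?_
            filter_upwards [ae_restrict_mem measurableSet_Ioi] with x hx
            have e : ‖v x‖ₑ ^ p.toReal = ‖v x‖ₑ ^ (p.toReal - 1) * ‖v x‖ₑ := by
              conv_rhs => rw [← ENNReal.rpow_one ‖v x‖ₑ, ← ENNReal.rpow_mul, one_mul]
              rw [← ENNReal.rpow_add_of_nonneg _ _ (by linarith) zero_le_one]
              congr 1; ring
            rw [e]
            gcongr
            rw [Real.enorm_of_nonneg (hv0 x)]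
            · exact ENNReal.ofReal_le_ofReal (hsup x hx)
        _ = ENNReal.ofReal δ ^ (p.toReal - 1) * ∫⁻ x in Set.Ioi a, ‖v x‖ₑ := by
            rw [lintegral_const_mul']
            exact ENNReal.rpow_ne_top_of_nonneg (by linarith) ENNReal.ofReal_ne_top
        _ ≤ ENNReal.ofReal δ ^ (p.toReal - 1) * ENNReal.ofReal δ := by gcongr
        _ = ENNReal.ofReal δ ^ p.toReal := by
            conv_lhs => rw [← ENNReal.rpow_one (ENNReal.ofReal δ), ← ENNReal.rpow_mul, one_mul]
            rw [← ENNReal.rpow_add_of_nonneg _ _ (by linarith) zero_le_one]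
            congr 1; ring
    calc _ ≤ (ENNReal.ofReal δ ^ p.toReal) ^ (1 / p.toReal) := by gcongr
      _ = ENNReal.ofReal δ := by
        rw [← ENNReal.rpow_mul, mul_one_div_cancel (by linarith), ENNReal.rpow_one]

lemma phi_monotonicity {b : ℝ} (hb : b ∈ Set.Ioo (0 : ℝ) 3) {u : ℝ → ℝ → ℝ}
    (hu : IsH2NonnegMomentumSolution b u) {M σ : ℝ} (hMdef : M = ∫ x, mom u 0 x)
    (hσ : σ = M / 2 + K0 / 2 * (3 / 2 * M) + 1) {T R : ℝ} (hT : 0 ≤ T) (hR : 0 ≤ R) :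
    ∫ x, u T x * phiW (x - (σ * T + R)) ≤ ∫ x, u 0 x * phiW (x - R) := by
  obtain ⟨ht1, hx3, cu, cut, -, -, -, -, heq, hInteg, hmom, hcons⟩ := hu
  have hfacts := fun t (ht : 0 ≤ t) => slice_facts (hx3 t) (hInteg t ht).1 (hInteg t ht).2.2.1
    (hInteg t ht).2.2.2.2.1 (fun x => hmom t x ht)
  have hIM : ∀ t, 0 ≤ t → ∫ x, u t x = M := fun t ht => by
    rw [(hfacts t ht).2.1, hMdef]; exact hcons t ht
  have hu0 : ∀ t, 0 ≤ t → ∀ x, 0 ≤ u t x := fun t ht x =>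
    (abs_nonneg _).trans ((hfacts t ht).1 x)
  have huM : ∀ t, 0 ≤ t → ∀ x, u t x ≤ M := fun t ht x => by
    rw [← hIM t ht]
    exact ((hfacts t ht).2.2 x).trans
      (setIntegral_le_integral (hInteg t ht).1 (ae_of_all _ (hu0 t ht)))
  have hM0 : 0 ≤ M := (hu0 0 le_rfl 0).trans (huM 0 le_rfl 0)
  have hσ0 : 0 ≤ σ := by have := K0_nonneg; rw [hσ]; positivity
  set ε : ℝ → ℝ := fun L => (2 * M ^ 2 + σ * M) * (phiW (-L) + (1 - phiW (L - (σ * T + R))))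
    with hε
  have hfin : ∀ L, 0 ≤ L → ∫ x in (-L)..L, u T x * phiW (x - (σ * T + R))
      ≤ (∫ x in (-L)..L, u 0 x * phiW (x - R)) + T * ε L := by
    intro L hL
    have hg'c : Continuous (fun p : ℝ × ℝ => deriv (fun s => u s p.2) p.1
        * phiW (p.2 - (σ * p.1 + R)) - σ * (u p.1 p.2 * psiW (p.2 - (σ * p.1 + R)))) := by
      have h1 : Continuous (fun p : ℝ × ℝ => phiW (p.2 - (σ * p.1 + R))) :=
        phiW_cont.comp (by fun_prop)
      have h2 : Continuous (fun p : ℝ × ℝ => psiW (p.2 - (σ * p.1 + R))) :=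
        psiW_cont.comp (by fun_prop)
      exact (cut.mul h1).sub (continuous_const.mul (cu.mul h2))
    have hid := time_identity (g := fun t x => u t x * phiW (x - (σ * t + R)))
      (g' := fun t x => deriv (fun s => u s x) t * phiW (x - (σ * t + R))
        - σ * (u t x * psiW (x - (σ * t + R)))) hg'c
      (fun t => (hx3 t).continuous.mul (phiW_cont.comp (by fun_prop)))
      (fun t x => by
        have h1 : HasDerivAt (fun s => u s x) (deriv (fun s => u s x) t) t :=
          ((ht1 x).differentiable (by norm_num) t).hasDerivAt
        have h2 : HasDerivAt (fun s : ℝ => x - (σ * s + R)) (-σ) t := by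
          have := (((hasDerivAt_id t).const_mul σ).add_const R).const_sub x
          simpa using this
        have h3 := (phiW_hasDerivAt (x - (σ * t + R))).comp t h2
        exact (h1.mul h3).congr_deriv (by simp only [Function.comp]; ring)) T L hL
    simp only [mul_zero, zero_add] at hid
    have hle : ∫ t in (0 : ℝ)..T, ∫ x in (-L)..L, (deriv (fun s => u s x) t
        * phiW (x - (σ * t + R)) - σ * (u t x * psiW (x - (σ * t + R)))) ≤ ∫ t in (0 : ℝ)..T, ε L := by
      refine intervalIntegral.integral_mono_on_of_le_Ioo hT ?_ (by simp) ?_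
      · exact (intervalIntegral.continuous_parametric_intervalIntegral_of_continuous'
          (f := fun t x => deriv (fun s => u s x) t
        * phiW (x - (σ * t + R)) - σ * (u t x * psiW (x - (σ * t + R)))) hg'c _ _).intervalIntegrable _ _
      · intro t ht
        have ht0 : 0 ≤ t := ht.1.le
        have hs := slice_ineq hb (v := u t) (w := fun x => deriv (fun s => u s x) t)
          (F := flux b u t) (s := σ * t + R) (hx3 t) (hInteg t ht0).1 (hInteg t ht0).2.1
          (hInteg t ht0).2.2.2.1 (hfacts t ht0).1 (huM t ht0) (hIM t ht0) rfl rfl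
          (cut.comp (by fun_prop : Continuous fun x : ℝ => (t, x)))
          (fun x => heq t x ht.1) hσ hL
        refine hs.trans ?_
        have h1 : phiW (-L - (σ * t + R)) ≤ phiW (-L) := phiW_mono (by
          have := mul_nonneg hσ0 ht0
          linarith)
        have h2 : phiW (L - (σ * T + R)) ≤ phiW (L - (σ * t + R)) := phiW_mono (by
          have := mul_le_mul_of_nonneg_left ht.2.le hσ0
          linarith)
        exact mul_le_mul_of_nonneg_left (by linarith) (by positivity)
    rw [intervalIntegral.integral_const, sub_zero, smul_eq_mul] at hle
    linarith
  have hφi : ∀ t, 0 ≤ t → ∀ s, Integrable (fun x => u t x * phiW (x - s)) := fun t ht s => by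
    refine (hInteg t ht).1.mono' ((hx3 t).continuous.mul
      (phiW_cont.comp (by fun_prop))).aestronglyMeasurable (ae_of_all _ fun x => ?_)
    have h1 := phiW_pos (x - s)
    have h2 := phiW_lt_one (x - s)
    have h3 := hu0 t ht x
    rw [Real.norm_of_nonneg (by positivity)]
    nlinarith
  have l1 := intervalIntegral_tendsto_integral (hφi T hT (σ * T + R)) tendsto_neg_atTop_atBot
    tendsto_id
  have l2 := intervalIntegral_tendsto_integral (hφi 0 le_rfl R) tendsto_neg_atTop_atBot tendsto_id
  have l3 : Tendsto ε atTop (nhds 0) := by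
    have h1 := phiW_atBot.comp tendsto_neg_atTop_atBot
    have h2 := phiW_atTop.comp (tendsto_atTop_add_const_right atTop (-(σ * T + R)) tendsto_id)
    have := (h1.add (h2.const_sub 1)).const_mul (2 * M ^ 2 + σ * M)
    simp only [sub_self, add_zero, mul_zero] at this
    exact this
  have l4 := l2.add (l3.const_mul T)
  rw [mul_zero, add_zero] at l4
  exact le_of_tendsto_of_tendsto l1 l4 ((eventually_ge_atTop 0).mono fun L hL => hfin L hL)

/-- For a global classical `H²` solution with nonnegative momentum,
there is `σ > 0` such that for every `p ∈ [1,∞]`,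
`‖u(t)‖_{L^p((σt,∞))} + ‖∂ₓu(t)‖_{L^p((σt,∞))} → 0` as `t → ∞`; i.e. `u(t) → 0` in
`W^{1,p}` on the exterior region `(σt, ∞)`. -/
theorem exterior_W1p_decay (b : ℝ) (hb : b ∈ Set.Ioo (0 : ℝ) 3)
    (u : ℝ → ℝ → ℝ) (hu : IsH2NonnegMomentumSolution b u) :
    ∃ σ : ℝ, 0 < σ ∧ ∀ p : ENNReal, 1 ≤ p →
      Filter.Tendsto
        (fun t : ℝ =>
          eLpNorm (u t) p (volume.restrict (Set.Ioi (σ * t)))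
            + eLpNorm (deriv (u t)) p (volume.restrict (Set.Ioi (σ * t))))
        Filter.atTop (nhds 0) := by
  set M : ℝ := ∫ x, mom u 0 x with hMdef
  set σ : ℝ := M / 2 + K0 / 2 * (3 / 2 * M) + 1 with hσ
  have hmon := fun (T : ℝ) (hT : 0 ≤ T) => phi_monotonicity hb hu hMdef hσ hT hT
  obtain ⟨ht1, hx3, cu, cut, -, -, -, -, heq, hInteg, hmom, hcons⟩ := hu
  have hfacts := fun t (ht : 0 ≤ t) => slice_facts (hx3 t) (hInteg t ht).1 (hInteg t ht).2.2.1
    (hInteg t ht).2.2.2.2.1 (fun x => hmom t x ht)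
  have hu0 : ∀ t, 0 ≤ t → ∀ x, 0 ≤ u t x := fun t ht x =>
    (abs_nonneg _).trans ((hfacts t ht).1 x)
  have hM0 : 0 ≤ M := integral_nonneg fun x => hmom 0 x le_rfl
  have hσ0 : 0 < σ := by have := K0_nonneg; rw [hσ]; positivity
  set δ : ℝ → ℝ := fun T => 2 * ∫ x, u 0 x * phiW (x - T) with hδ
  have hδ0 : Tendsto δ atTop (nhds 0) := by
    have h : Tendsto (fun T : ℝ => ∫ x, u 0 x * phiW (x - T)) atTop (nhds (∫ _ : ℝ, (0 : ℝ))) := by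
      refine tendsto_integral_filter_of_dominated_convergence (u 0)
        (Eventually.of_forall fun T => ((hx3 0).continuous.mul
          (phiW_cont.comp (by fun_prop))).aestronglyMeasurable)
        (Eventually.of_forall fun T => ae_of_all _ fun x => ?_) (hInteg 0 le_rfl).1
        (ae_of_all _ fun x => ?_)
      · have h1 := phiW_pos (x - T)
        have h2 := phiW_lt_one (x - T)
        have h3 := hu0 0 le_rfl x
        rw [Real.norm_of_nonneg (by positivity)]
        nlinarith
      · have h1 : Tendsto (fun T : ℝ => x - T) atTop atBot := by
          have := tendsto_atBot_add_const_left atTop x tendsto_neg_atTop_atBot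
          simpa [sub_eq_add_neg] using this
        simpa using (phiW_atBot.comp h1).const_mul (u 0 x)
    simpa using h.const_mul 2
  refine ⟨σ + 1, by linarith, fun p hp => ?_⟩
  have hL1 : ∀ T, 0 ≤ T → ∫ x in Set.Ioi ((σ + 1) * T), u T x ≤ δ T := by
    intro T hT
    have hm := hmon T hT
    have hφi : Integrable (fun x => u T x * phiW (x - (σ * T + T))) := by
      refine (hInteg T hT).1.mono' ((hx3 T).continuous.mul
        (phiW_cont.comp (by fun_prop))).aestronglyMeasurable (ae_of_all _ fun x => ?_)
      have h1 := phiW_pos (x - (σ * T + T))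
      have h2 := phiW_lt_one (x - (σ * T + T))
      have h3 := hu0 T hT x
      rw [Real.norm_of_nonneg (by positivity)]
      nlinarith
    have h0 : phiW 0 = 1 / 2 := by simp [phiW]
    have h1 : ∫ x in Set.Ioi ((σ + 1) * T), u T x
        ≤ ∫ x in Set.Ioi ((σ + 1) * T), 2 * (u T x * phiW (x - (σ * T + T))) := by
      refine setIntegral_mono_on (hInteg T hT).1.integrableOn (hφi.const_mul 2).integrableOn
        measurableSet_Ioi fun x hx => ?_
      have h2 : phiW 0 ≤ phiW (x - (σ * T + T)) := phiW_mono (by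
        have : (σ + 1) * T < x := hx
        linarith)
      rw [h0] at h2
      have h3 := hu0 T hT x
      nlinarith
    have h2 : ∫ x in Set.Ioi ((σ + 1) * T), 2 * (u T x * phiW (x - (σ * T + T)))
        ≤ ∫ x, 2 * (u T x * phiW (x - (σ * T + T))) :=
      setIntegral_le_integral (hφi.const_mul 2) (ae_of_all _ fun x =>
        mul_nonneg (by norm_num) (mul_nonneg (hu0 T hT x) (phiW_pos _).le))
    rw [integral_const_mul] at h1
    simp only [integral_const_mul] at h2
    simp only [hδ]
    linarith
  have hbd : ∀ T, 0 ≤ T → eLpNorm (u T) p (volume.restrict (Set.Ioi ((σ + 1) * T)))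
      + eLpNorm (deriv (u T)) p (volume.restrict (Set.Ioi ((σ + 1) * T)))
      ≤ ENNReal.ofReal (δ T) + ENNReal.ofReal (δ T) := by
    intro T hT
    have h1 := eLpNorm_le_of_L1_Linf (hu0 T hT) (hInteg T hT).1 (fun x hx =>
      (((hfacts T hT).2.2 x).trans (setIntegral_mono_set (hInteg T hT).1.integrableOn
        (ae_of_all _ (hu0 T hT)) (LE.le.eventuallyLE (Set.Ioi_subset_Ioi hx.le)))).trans
          (hL1 T hT)) (hL1 T hT) p hp
    refine add_le_add h1 (le_trans (eLpNorm_mono fun x => ?_) h1)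
    rw [Real.norm_eq_abs, Real.norm_of_nonneg (hu0 T hT x)]
    exact (hfacts T hT).1 x
  have hlim : Tendsto (fun T => ENNReal.ofReal (δ T) + ENNReal.ofReal (δ T)) atTop (nhds 0) := by
    have := ENNReal.tendsto_ofReal hδ0
    simpa using this.add this
  exact tendsto_of_tendsto_of_tendsto_of_le_of_le' tendsto_const_nhds hlim
    (Eventually.of_forall fun _ => zero_le) ((eventually_ge_atTop 0).mono hbd)
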